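/- Let n ≥ 5 be an odd prime and let q = 2^f for some positive integer f. If q^n - 1 has exactly one primitive prime divisor r (i.e., P_q^n = {r}), then r ≥ 4nf + 1. -/

import Mathlib

/-- The set of primitive prime divisors of `a^n - 1`. -/
def ppdSet (a n : ℕ) : Set ℕ :=
  {r | r.Prime ∧ r ∣ a ^ n - 1 ∧ ∀ i, 1 ≤ i → i < n → ¬ r ∣ a ^ i - 1}

open Finset

theorem pred_mul_natGeomSum {x : ℕ} (hx : 1 ≤ x) (n : ℕ) :
    (x - 1) * ∑ i ∈ range n, x ^ i = x ^ n - 1 := by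
  have h1 : 1 ≤ x ^ n := Nat.one_le_pow _ _ hx
  zify [hx, h1]
  exact mul_geom_sum (x : ℤ) n

theorem prime_dvd_of_dvd_natGeomSum {p x n : ℕ} (hx : 1 ≤ x)
    (h1 : p ∣ x - 1) (hS : p ∣ ∑ i ∈ range n, x ^ i) : p ∣ n := by
  have hx1 : (x : ZMod p) = 1 := by
    have := (ZMod.natCast_eq_zero_iff (x - 1) p).2 h1
    rw [Nat.cast_sub hx, Nat.cast_one] at this
    exact sub_eq_zero.1 this
  have := (ZMod.natCast_eq_zero_iff _ p).2 hS
  push_cast at this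
  rw [hx1] at this
  simpa [ZMod.natCast_eq_zero_iff] using this

theorem natCast_pow_eq_one_iff_dvd {p x : ℕ} (hx : 1 ≤ x) (i : ℕ) :
    (x : ZMod p) ^ i = 1 ↔ p ∣ x ^ i - 1 := by
  rw [← ZMod.natCast_eq_zero_iff, Nat.cast_sub (Nat.one_le_pow _ _ hx), sub_eq_zero]
  push_cast
  rfl

theorem mem_ppdSet_iff {a n p : ℕ} (ha : 1 ≤ a) (hn : 0 < n) :
    p ∈ ppdSet a n ↔ p.Prime ∧ orderOf (a : ZMod p) = n := by
  simp only [ppdSet, Set.mem_ofPred_eq, ← natCast_pow_eq_one_iff_dvd ha]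
  refine and_congr_right fun _ => ?_
  rw [orderOf_eq_iff hn]
  exact and_congr_right fun _ =>
    ⟨fun h i hi hi0 => h i hi0 hi, fun h i hi0 hi => h i hi hi0⟩

theorem orderOf_eq_of_dvd_natGeomSum {p x n : ℕ} (hn : n.Prime) (hx : 1 ≤ x)
    (h1 : ¬ p ∣ x - 1) (hS : p ∣ ∑ i ∈ range n, x ^ i) : orderOf (x : ZMod p) = n := by
  have := Fact.mk hn
  refine orderOf_eq_prime ?_ fun h => h1 ?_
  · rw [natCast_pow_eq_one_iff_dvd hx, ← pred_mul_natGeomSum hx]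
    exact hS.mul_left _
  · have := (natCast_pow_eq_one_iff_dvd (p := p) hx 1).1 (by simpa using h)
    simpa using this

theorem padicValNat_natGeomSum_of_dvd {n q : ℕ} (hn : n.Prime) (hodd : Odd n) (hq : 2 ≤ q)
    (h : n ∣ q - 1) : padicValNat n (∑ i ∈ range n, q ^ i) = 1 := by
  have := Fact.mk hn
  have hnq : ¬ n ∣ q := fun hd => hn.one_lt.ne' <| by
    have := (Nat.dvd_sub hd h)
    rw [Nat.sub_sub_self (by omega)] at this
    exact Nat.dvd_one.1 this
  have key := padicValNat.pow_sub_pow hodd (show 1 < q by omega) h hnq hn.ne_zero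
  have hS : ∑ i ∈ range n, q ^ i ≠ 0 := by
    refine (Finset.sum_pos (fun i _ => by positivity) ?_).ne'
    simpa using hn.ne_zero
  rw [one_pow, ← pred_mul_natGeomSum (by omega), padicValNat.mul (by omega) hS,
    padicValNat_self] at key
  omega

/-- If every prime divisor of the geometric sum of `x ^ m` is `n` or the odd prime `r`, where `x`
has order `n` modulo `r`, then that sum is controlled by the one of `x`. -/
theorem natGeomSum_pow_dvd {n r x m : ℕ} (hn : n.Prime) (hodd : Odd n) (hr : r.Prime)
    (hrodd : Odd r) (hx : 2 ≤ x) (hm : m ≠ 0) (hrS : r ∣ x ^ n - 1)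
    (hrx : ¬ r ∣ x - 1) (hrq : ¬ r ∣ x ^ m - 1)
    (hprimes : ∀ p, p.Prime → p ∣ ∑ i ∈ range n, (x ^ m) ^ i → ¬ p ∣ x ^ m - 1 → p = r) :
    ∑ i ∈ range n, (x ^ m) ^ i ∣ (x ^ m - 1) * m * ∑ i ∈ range n, x ^ i := by
  have hq : 2 ≤ x ^ m := hx.trans (Nat.le_self_pow hm x)
  have hpos : ∀ y : ℕ, 2 ≤ y → ∑ i ∈ range n, y ^ i ≠ 0 := fun y hy =>
    (Finset.sum_pos (fun i _ => by positivity) (by simpa using hn.ne_zero)).ne'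
  have hSx := hpos x hx
  have hSq := hpos _ hq
  have hq1 : x ^ m - 1 ≠ 0 := by omega
  refine (Nat.factorization_prime_le_iff_dvd hSq
    (mul_ne_zero (mul_ne_zero hq1 hm) hSx)).1 fun p hp => ?_
  have := Fact.mk hp
  rw [Nat.factorization_def _ hp, Nat.factorization_def _ hp,
    padicValNat.mul (mul_ne_zero hq1 hm) hSx, padicValNat.mul hq1 hm]
  by_cases hpS : p ∣ ∑ i ∈ range n, (x ^ m) ^ i
  swap
  · simp [padicValNat.eq_zero_of_not_dvd hpS]
  by_cases hpq : p ∣ x ^ m - 1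
  · obtain rfl : p = n :=
      (Nat.prime_dvd_prime_iff_eq hp hn).1 (prime_dvd_of_dvd_natGeomSum (by omega) hpq hpS)
    rw [padicValNat_natGeomSum_of_dvd hp hodd hq hpq]
    have := one_le_padicValNat_of_dvd hq1 hpq
    omega
  · obtain rfl := hprimes p hp hpS hpq
    have hpx : ¬ p ∣ x ^ n := fun hd => hp.one_lt.ne' <| by
      have := Nat.dvd_sub hd hrS
      rw [Nat.sub_sub_self (Nat.one_le_pow _ _ (by omega))] at this
      exact Nat.dvd_one.1 this
    have key := padicValNat.pow_sub_pow hrodd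
      (Nat.one_lt_pow hn.ne_zero (by omega : 1 < x)) hrS hpx hm
    rw [one_pow, ← pow_mul, mul_comm n m, pow_mul,
      ← pred_mul_natGeomSum (x := x ^ m) (by omega), ← pred_mul_natGeomSum (n := n) (x := x)
      (by omega), padicValNat.mul hq1 hSq, padicValNat.mul (by omega) hSx,
      padicValNat.eq_zero_of_not_dvd hrx, padicValNat.eq_zero_of_not_dvd hrq] at key
    omega

theorem two_mul_le_two_pow {m : ℕ} (hm : 2 ≤ m) : 2 * m ≤ 2 ^ (3 * m - 4) := by
  have h := Nat.lt_two_pow_self (n := m - 1)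
  calc 2 * m ≤ 2 * 2 ^ (m - 1) := by omega
    _ = 2 ^ m := by rw [← pow_succ', Nat.sub_add_cancel (by omega)]
    _ ≤ 2 ^ (3 * m - 4) := by
      exact Nat.pow_le_pow_right (by norm_num) (by omega)

theorem eq_one_of_natGeomSum_pow_dvd {n x m : ℕ} (hn : 5 ≤ n) (hx : 2 ≤ x) (hm : m ≠ 0)
    (h : ∑ i ∈ range n, (x ^ m) ^ i ∣ (x ^ m - 1) * m * ∑ i ∈ range n, x ^ i) : m = 1 := by
  by_contra hm1
  have hm2 : 2 ≤ m := by omega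
  have hq : 2 ≤ x ^ m := hx.trans (Nat.le_self_pow hm x)
  obtain ⟨k, rfl⟩ : ∃ k, n = k + 1 := ⟨n - 1, by omega⟩
  have hSpos : 0 < ∑ i ∈ range (k + 1), x ^ i :=
    Finset.sum_pos (fun i _ => by positivity) (by simp)
  have hle := Nat.le_of_dvd (Nat.mul_pos (Nat.mul_pos (by omega) (by omega)) hSpos) h
  have hlow : (x ^ m) ^ k ≤ ∑ i ∈ range (k + 1), (x ^ m) ^ i :=
    Finset.single_le_sum (f := fun i => (x ^ m) ^ i) (fun i _ => Nat.zero_le _) (by simp)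
  have hup : ∑ i ∈ range (k + 1), x ^ i < 2 * x ^ k := by
    rw [Finset.sum_range_succ]
    have := Nat.geomSum_lt (m := x) (n := k) (s := range k) hx (by simp)
    omega
  have hlt : (x ^ m) ^ k < x ^ m * m * (2 * x ^ k) := by
    refine (hlow.trans hle).trans_lt ?_
    refine Nat.mul_lt_mul_of_le_of_lt (Nat.mul_le_mul_right _ (Nat.sub_le _ _)) hup ?_
    exact Nat.mul_pos (by omega) (by omega)
  have hexp : m + k + (3 * m - 4) ≤ m * k := by
    obtain ⟨j, rfl⟩ := Nat.exists_eq_add_of_le hm2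
    obtain ⟨l, rfl⟩ := Nat.exists_eq_add_of_le (show 4 ≤ k by omega)
    have : 3 * (2 + j) - 4 = 2 + 3 * j := by omega
    rw [this]
    nlinarith
  have : x ^ m * m * (2 * x ^ k) ≤ (x ^ m) ^ k := by
    calc x ^ m * m * (2 * x ^ k) = x ^ (m + k) * (2 * m) := by ring
      _ ≤ x ^ (m + k) * x ^ (3 * m - 4) := by
        refine Nat.mul_le_mul_left _ ((two_mul_le_two_pow hm2).trans ?_)
        exact Nat.pow_le_pow_left hx _
      _ = x ^ (m + k + (3 * m - 4)) := by rw [← pow_add]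
      _ ≤ x ^ (m * k) := Nat.pow_le_pow_right (by omega) hexp
      _ = (x ^ m) ^ k := pow_mul _ _ _
  omega

theorem quartic_lt_two_pow {f : ℕ} (hf : 25 ≤ f) : 2 * (f ^ 2 + 1) * f ^ 2 < 2 ^ f := by
  induction f, hf using Nat.le_induction with
  | base => norm_num
  | succ k hk ih =>
    rw [pow_succ 2 k]
    obtain ⟨j, rfl⟩ := Nat.exists_eq_add_of_le hk
    ring_nf at ih ⊢
    nlinarith

theorem mod_eight_eq_seven {N r : ℕ} (hr : r.Prime) (hN : Odd N) (hrN : r = 2 * N + 1)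
    (h : (2 : ZMod r) ^ N = 1) : r % 8 = 7 := by
  have := Fact.mk hr
  obtain ⟨k, rfl⟩ := hN
  have hsq : IsSquare (2 : ZMod r) := by
    refine ⟨2 ^ (k + 1), ?_⟩
    calc (2 : ZMod r) = 2 ^ (2 * k + 1) * 2 := by rw [h, one_mul]
      _ = _ := by ring
  have := (ZMod.exists_sq_eq_two_iff (by omega)).1 hsq
  omega

theorem pow_mod_eight_of_odd {r c : ℕ} (hr : r % 8 = 7) (hc : Odd c) : r ^ c % 8 = 7 := by
  obtain ⟨k, rfl⟩ := hc
  rw [pow_succ, pow_mul, Nat.mul_mod, Nat.pow_mod, Nat.pow_mod r 2, hr]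
  simp

theorem pow_mod_eight_of_even {r c : ℕ} (hr : r % 8 = 7) (hc : Even c) : r ^ c % 8 = 1 := by
  obtain ⟨k, rfl⟩ := hc
  rw [← two_mul, pow_mul, Nat.pow_mod, Nat.pow_mod r 2, hr]
  simp

theorem mersenne_ne_pow {n r c : ℕ} (hn5 : 5 ≤ n) (hrn : r = 2 * n + 1) (hr8 : r % 8 = 7)
    (hord : orderOf (2 : ZMod r) = n) : 2 ^ n - 1 ≠ r ^ c := by
  intro h
  have h8 : 8 ∣ 2 ^ n := pow_dvd_pow 2 (show 3 ≤ n by omega)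
  have hpos : 1 ≤ 2 ^ n := Nat.one_le_two_pow
  rcases Nat.even_or_odd c with hc | hc
  · have := pow_mod_eight_of_even hr8 hc
    omega
  · have hd := Odd.nat_add_dvd_pow_add_pow r 1 hc
    rw [one_pow, ← h, Nat.sub_add_cancel hpos, Nat.dvd_prime_pow Nat.prime_two] at hd
    obtain ⟨j, hj, hrj⟩ := hd
    have h1 : (2 : ZMod r) ^ j = 1 := by
      have := congrArg (Nat.cast (R := ZMod r)) hrj
      push_cast at this
      rw [← this]
      simp
    have hnj := orderOf_dvd_of_pow_eq_one h1
    rw [hord] at hnj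
    have hj0 : j ≠ 0 := by
      rintro rfl
      simp at hrj
      omega
    obtain rfl : j = n := le_antisymm hj (Nat.le_of_dvd (by omega) hnj)
    have hbig : ∀ k, 5 ≤ k → 2 * k + 2 < 2 ^ k := by
      intro k hk
      induction k, hk using Nat.le_induction with
      | base => norm_num
      | succ k hk ih => rw [pow_succ]; omega
    have := hbig j hn5
    omega

theorem natGeomSum_two_pow_ne_pow {n f r c : ℕ} (hn : 2 ≤ n) (hf : 25 ≤ f) (hnf : n ≤ f)
    (hodd : Odd (n * f)) (hrn : r = 2 * (n * f) + 1) (hr8 : r % 8 = 7) :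
    ∑ i ∈ range n, (2 ^ f) ^ i ≠ r ^ c := by
  intro h
  have hxS : 2 ^ f ∣ r ^ c - 1 := by
    obtain ⟨k, rfl⟩ : ∃ k, n = k + 1 := ⟨n - 1, by omega⟩
    rw [← h, geom_sum_succ, Nat.add_sub_cancel]
    exact Dvd.intro _ rfl
  have hpow : 1 ≤ r ^ c := Nat.one_le_pow _ _ (by omega)
  have h8 : 8 ∣ r ^ c - 1 := (pow_dvd_pow 2 (show 3 ≤ f by omega)).trans hxS
  have hc : Even c := by
    rw [← Nat.not_odd_iff_even]
    intro hc
    have := pow_mod_eight_of_odd hr8 hc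
    omega
  have hlt : r ^ c < 2 ^ (n * f) := by
    rw [← h, mul_comm n f, pow_mul]
    exact Nat.geomSum_lt (Nat.le_self_pow (by omega) 2) (by simp)
  have hcN : c < n * f := by
    refine (Nat.pow_lt_pow_iff_right (a := 2) (by norm_num)).1 (lt_of_le_of_lt ?_ hlt)
    exact Nat.pow_le_pow_left (by omega) c
  have hc0 : c ≠ 0 := by
    rintro rfl
    have : 1 + 2 ^ f ≤ ∑ i ∈ range n, (2 ^ f) ^ i := by
      calc 1 + 2 ^ f = ∑ i ∈ range 2, (2 ^ f) ^ i := by simp [Finset.sum_range_succ]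
        _ ≤ _ := Finset.sum_le_sum_of_subset (by simpa using hn)
    have h2 : 0 < 2 ^ f := by positivity
    rw [h, pow_zero] at this
    omega
  have hr1 : 1 < r := by omega
  have key := padicValNat.pow_two_sub_one hr1 (by omega) hc0 hc
  have hv1 : padicValNat 2 (r - 1) = 1 := by
    rw [hrn, Nat.add_sub_cancel, padicValNat.mul (by norm_num) (by omega), padicValNat_self,
      padicValNat.eq_zero_of_not_dvd]
    rw [← even_iff_two_dvd, Nat.not_even_iff_odd]
    exact hodd
  have hne : r ^ c - 1 ≠ 0 := by
    have := Nat.one_lt_pow hc0 hr1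
    omega
  have hfv : f ≤ padicValNat 2 (r ^ c - 1) := (padicValNat_dvd_iff_le hne).1 hxS
  have hdvd : 2 ^ f ∣ (r + 1) * c := by
    rw [padicValNat_dvd_iff_le (mul_ne_zero (by omega) hc0), padicValNat.mul (by omega) hc0]
    omega
  have hle := Nat.le_of_dvd (Nat.mul_pos (by omega) (by omega)) hdvd
  have hbig := quartic_lt_two_pow hf
  have hNf : n * f ≤ f ^ 2 := by
    rw [sq]
    exact Nat.mul_le_mul_right _ hnf
  have : (r + 1) * c ≤ 2 * (f ^ 2 + 1) * f ^ 2 := Nat.mul_le_mul (by omega) (by omega)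
  omega

/-- Lemma 2.10: if `n ≥ 5` is an odd prime, `q = 2^f`, and `q^n - 1` has a
unique primitive prime divisor `r`, then `r ≥ 4nf + 1`. -/
theorem stmt11 (n f q r : ℕ) (hn : n.Prime) (hn5 : 5 ≤ n) (hodd : Odd n)
    (hf : 0 < f) (hq : q = 2 ^ f) (h : ppdSet q n = {r}) :
    4 * n * f + 1 ≤ r := by
  have := Fact.mk hn
  have hq1 : 1 ≤ q := hq ▸ Nat.one_le_two_pow
  have hmem : ∀ p, p.Prime ∧ orderOf (q : ZMod p) = n ↔ p = r := fun p => by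
    rw [← mem_ppdSet_iff hq1 hn.pos, h, Set.mem_singleton_iff]
  obtain ⟨hr, hrq⟩ := (hmem r).2 rfl
  have := Fact.mk hr
  obtain ⟨b, m, hnm, hfm⟩ := Nat.exists_eq_pow_mul_and_not_dvd hf.ne' n hn.ne_one
  have hm : m ≠ 0 := by rintro rfl; simp at hnm
  obtain ⟨x, hx⟩ : ∃ x, x = 2 ^ n ^ b := ⟨_, rfl⟩
  have hqx : q = x ^ m := by rw [hq, hfm, pow_mul, hx]
  have hx2 : 2 ≤ x := hx ▸ Nat.le_self_pow (pow_ne_zero _ hn.ne_zero) 2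
  have hnx : ¬ n ∣ x - 1 := by
    intro hd
    have h1 := (natCast_pow_eq_one_iff_dvd (p := n) (x := x) (by omega) 1).2 (by simpa using hd)
    rw [hx, pow_one] at h1
    push_cast at h1
    rw [ZMod.pow_card_pow] at h1
    have h2 : (1 : ZMod n) = 0 := by linear_combination h1
    exact one_ne_zero h2
  have hcop : n.Coprime m := (Nat.Prime.coprime_iff_not_dvd hn).2 hnm
  have hx_primes : ∀ {p : ℕ}, p.Prime → p ∣ ∑ i ∈ range n, x ^ i →
      orderOf (x : ZMod p) = n ∧ p = r := by
    intro p hp hpS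
    have hpx : ¬ p ∣ x - 1 := fun hd => by
      have := prime_dvd_of_dvd_natGeomSum (by omega) hd hpS
      rw [(Nat.prime_dvd_prime_iff_eq hp hn).1 this] at hd
      exact hnx hd
    have ho := orderOf_eq_of_dvd_natGeomSum hn (by omega) hpx hpS
    refine ⟨ho, (hmem p).1 ⟨hp, ?_⟩⟩
    rw [hqx, Nat.cast_pow, Nat.Coprime.orderOf_pow (by rwa [ho]), ho]
  have hSx_gt : 1 + x ≤ ∑ i ∈ range n, x ^ i := by
    calc 1 + x = ∑ i ∈ range 2, x ^ i := by simp [Finset.sum_range_succ]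
      _ ≤ _ := Finset.sum_le_sum_of_subset (by simpa using hn.two_le)
  obtain ⟨c, hc⟩ : ∃ c, ∑ i ∈ range n, x ^ i = r ^ c :=
    ⟨_, Nat.eq_prime_pow_of_unique_prime_dvd (by omega) fun hd hdS => (hx_primes hd hdS).2⟩
  have hrx : orderOf (x : ZMod r) = n := by
    obtain ⟨p, hp, hpS⟩ := Nat.exists_prime_and_dvd (show ∑ i ∈ range n, x ^ i ≠ 1 by omega)
    obtain ⟨ho, rfl⟩ := hx_primes hp hpS
    exact ho
  have hxn : (x : ZMod r) ^ n = 1 := by rw [← hrx]; exact pow_orderOf_eq_one _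
  have hnot : ∀ y : ℕ, 1 ≤ y → orderOf (y : ZMod r) = n → ¬ r ∣ y - 1 := by
    intro y hy ho hd
    have h1 := (natCast_pow_eq_one_iff_dvd (p := r) hy 1).2 (by simpa using hd)
    rw [pow_one] at h1
    rw [h1, orderOf_one] at ho
    omega
  have hrx1 := hnot x (by omega) hrx
  have hord : orderOf (2 : ZMod r) = n ^ (b + 1) := by
    have hcast : (x : ZMod r) = 2 ^ n ^ b := by rw [hx]; push_cast; rfl
    refine orderOf_eq_prime_pow ?_ ?_
    · rw [← hcast]
      intro h1
      rw [h1, orderOf_one] at hrx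
      omega
    · rw [pow_succ n b, pow_mul, ← hcast, hxn]
  have h2r : (2 : ZMod r) ≠ 0 := by
    intro h0
    rw [h0] at hord
    have h1 := pow_orderOf_eq_one (0 : ZMod r)
    rw [hord, zero_pow (pow_ne_zero _ hn.ne_zero)] at h1
    exact zero_ne_one h1
  have hrodd : Odd r := hr.odd_of_ne_two <| by
    rintro rfl
    exact h2r (CharP.cast_eq_zero (ZMod 2) 2)
  have hm1 : m = 1 := by
    refine eq_one_of_natGeomSum_pow_dvd hn5 hx2 hm
      (natGeomSum_pow_dvd hn hodd hr hrodd hx2 hm ?_ hrx1 ?_ ?_)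
    · exact (natCast_pow_eq_one_iff_dvd (by omega) n).1 hxn
    · rw [← hqx]
      exact hnot q hq1 hrq
    · intro p hp hpS hpq
      rw [← hqx] at hpS hpq
      exact (hmem p).1 ⟨hp, orderOf_eq_of_dvd_natGeomSum hn hq1 hpq hpS⟩
  rw [hm1, mul_one] at hfm
  have hNf : n ^ (b + 1) = n * f := by rw [hfm, pow_succ']
  have hNodd : Odd (n * f) := hNf ▸ hodd.pow
  rw [hNf] at hord
  have hdvd := ZMod.orderOf_dvd_card_sub_one h2r
  rw [hord] at hdvd
  obtain ⟨k, hk⟩ := hdvd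
  have hr2 := hr.two_le
  have hkeven : Even k := by
    have : Even (n * f * k) := hk ▸ hrodd.tsub_odd odd_one
    exact (Nat.even_mul.1 this).resolve_left (Nat.not_even_iff_odd.2 hNodd)
  have hk0 : k ≠ 0 := by rintro rfl; omega
  have hk2 : k ≠ 2 := by
    rintro rfl
    have hrN : r = 2 * (n * f) + 1 := by omega
    have hr8 := mod_eight_eq_seven hr hNodd hrN (by rw [← hord]; exact pow_orderOf_eq_one _)
    rcases Nat.even_or_odd b with hb | ⟨l, hb⟩
    · rcases Nat.eq_zero_or_pos b with rfl | hb0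
      · obtain rfl : f = 1 := by simpa using hfm
        rw [mul_one] at hord hrN
        refine mersenne_ne_pow hn5 hrN hr8 hord (c := c) ?_
        rw [← hc, hx, ← pred_mul_natGeomSum (by norm_num)]
        simp
      · have hb2 : 2 ≤ b := by
          obtain ⟨l, hl⟩ := hb
          omega
        have hnf2 : n ^ 2 ≤ f := hfm ▸ Nat.pow_le_pow_right hn.pos hb2
        refine natGeomSum_two_pow_ne_pow (c := c) hn.two_le (by nlinarith) (by nlinarith)
          hNodd hrN hr8 ?_
        rw [← hc, hx, hfm]
    · have hN8 : (n * f) % 8 = 1 := by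
        have h1 : (n * f) % 8 = n ^ (l + 1) % 8 * (n ^ (l + 1) % 8) % 8 := by
          rw [← Nat.mul_mod, ← hNf, hb, ← pow_add]
          ring_nf
        have h2 : n ^ (l + 1) % 2 = 1 := Nat.odd_iff.1 hodd.pow
        have h3 : n ^ (l + 1) % 8 = 1 ∨ n ^ (l + 1) % 8 = 3 ∨ n ^ (l + 1) % 8 = 5 ∨
          n ^ (l + 1) % 8 = 7 := by omega
        rcases h3 with h3 | h3 | h3 | h3 <;> rw [h1, h3]
      omega
  have hk4 : 4 ≤ k := by
    obtain ⟨l, hl⟩ := hkeven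
    omega
  have : n * f * 4 ≤ n * f * k := Nat.mul_le_mul_left _ hk4
  calc 4 * n * f + 1 = n * f * 4 + 1 := by ring
    _ ≤ r := by omega
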